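/- arXiv:1209.3993 — 2 statements merged into one kernel-verified Lean document; each statement's English description precedes it below -/
import Mathlib

section
/- Let E and F be real seminormed spaces and let T : E → F be a bounded linear operator. Then for every integer k ≥ 1 one has l_k(T) ≤ d_k(T) and d_k(T) ≤ k² · l_k(T). -/
open scoped Pointwise ENNReal Topology

/-- The `k`-th Kolmogoroff diameter of `X` with respect to `Y`:
`inf {c > 0 : ∃ L with dim L < k and X ⊆ c•Y + L}`, in `[0,∞]` (with `inf ∅ = ∞`). -/
noncomputable def kolDiam {E : Type*} [AddCommGroup E] [Module ℝ E] (X Y : Set E) (k : ℕ) : ℝ≥0∞ :=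
  sInf (ENNReal.ofReal '' {c : ℝ | 0 < c ∧
    ∃ L : Submodule ℝ E, Module.rank ℝ L < k ∧ X ⊆ c • Y + (L : Set E)})

/-- `d_k(T) = d_k(T(U_E), U_F)` for a bounded linear operator `T` between seminormed spaces. -/
noncomputable def dkOp {E F : Type*} [SeminormedAddCommGroup E] [NormedSpace ℝ E]
    [SeminormedAddCommGroup F] [NormedSpace ℝ F] (T : E →L[ℝ] F) (k : ℕ) : ℝ≥0∞ :=
  kolDiam (T '' Metric.closedBall 0 1) (Metric.closedBall 0 1) k

/-- `l_k(T) = sup { d_k(T|_N) : N ≤ E, dim N ≤ k }`; note that the unit ball of a subspace `N`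
with the inherited seminorm is `N ∩ U_E`, so `d_k(T|_N) = d_k(T(N ∩ U_E), U_F)`. -/
noncomputable def lkOp {E F : Type*} [SeminormedAddCommGroup E] [NormedSpace ℝ E]
    [SeminormedAddCommGroup F] [NormedSpace ℝ F] (T : E →L[ℝ] F) (k : ℕ) : ℝ≥0∞ :=
  ⨆ (N : Submodule ℝ E) (_ : Module.rank ℝ N ≤ k),
    kolDiam (T '' ((N : Set E) ∩ Metric.closedBall 0 1)) (Metric.closedBall 0 1) k

theorem kolDiam_mono_left {E : Type*} [AddCommGroup E] [Module ℝ E] {X X' : Set E} (h : X ⊆ X')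
    (Y : Set E) (k : ℕ) : kolDiam X Y k ≤ kolDiam X' Y k := by
  refine sInf_le_sInf (Set.image_mono ?_)
  rintro c ⟨hc, L, hL, hX⟩
  exact ⟨hc, L, hL, h.trans hX⟩

theorem kolDiam_succ_le {E : Type*} [AddCommGroup E] [Module ℝ E] (X Y : Set E) (k : ℕ) :
    kolDiam X Y (k + 1) ≤ kolDiam X Y k := by
  refine sInf_le_sInf (Set.image_mono ?_)
  rintro c ⟨hc, L, hL, hX⟩
  exact ⟨hc, L, hL.trans_le (by exact_mod_cast Nat.le_succ k), hX⟩

theorem lkOp_le_dkOp {E F : Type*} [SeminormedAddCommGroup E] [NormedSpace ℝ E]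
    [SeminormedAddCommGroup F] [NormedSpace ℝ F] (T : E →L[ℝ] F) (k : ℕ) :
    lkOp T k ≤ dkOp T k :=
  iSup₂_le fun _ _ => kolDiam_mono_left (Set.image_mono Set.inter_subset_right) _ _

theorem rank_span_range_fin_le {E : Type*} [AddCommGroup E] [Module ℝ E] {n : ℕ} (x : Fin n → E) :
    Module.rank ℝ (Submodule.span ℝ (Set.range x)) ≤ n := by
  refine (rank_span_le _).trans ?_
  simpa using Cardinal.mk_range_le_lift (f := x)

/-- In a seminormed space, the seminorm is determined by the functionals of norm at most one. -/
theorem norm_le_of_forall_dual_le {F : Type*} [SeminormedAddCommGroup F] [NormedSpace ℝ F]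
    {y : F} {c : ℝ} (h : ∀ f : StrongDual ℝ F, ‖f‖ ≤ 1 → |f y| ≤ c) : ‖y‖ ≤ c := by
  obtain ⟨f, hf, hfy⟩ := exists_dual_vector'' ℝ y
  have := h f hf
  rw [hfy] at this
  exact (le_abs_self _).trans (by simpa using this)

theorem mem_smul_unitClosedBall_iff {F : Type*} [SeminormedAddCommGroup F] [NormedSpace ℝ F]
    {c : ℝ} (hc : 0 < c) {y : F} : y ∈ c • Metric.closedBall (0 : F) 1 ↔ ‖y‖ ≤ c := by
  rw [Set.mem_smul_set_iff_inv_smul_mem₀ hc.ne', mem_closedBall_zero_iff, norm_smul, norm_inv,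
    Real.norm_of_nonneg hc.le, inv_mul_le_iff₀ hc, mul_one]

section DetSup

variable {E F : Type*} [SeminormedAddCommGroup E] [NormedSpace ℝ E]
  [SeminormedAddCommGroup F] [NormedSpace ℝ F]

/-- The matrix of the values of the functionals `f` on the images under `T` of the vectors `x`. -/
def dualMatrix (T : E →L[ℝ] F) {n : ℕ} (x : Fin n → E) (f : Fin n → StrongDual ℝ F) :
    Matrix (Fin n) (Fin n) ℝ :=
  Matrix.of fun i j => f i (T (x j))

/-- The supremum of `|det (f i (T (x j)))|` over `n` vectors `x j` and `n` functionals `f i` in the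
respective unit balls. -/
noncomputable def detSup (T : E →L[ℝ] F) (n : ℕ) : ℝ≥0∞ :=
  ⨆ (x : Fin n → E) (f : Fin n → StrongDual ℝ F) (_ : (∀ j, ‖x j‖ ≤ 1) ∧ ∀ i, ‖f i‖ ≤ 1),
    ENNReal.ofReal |(dualMatrix T x f).det|

variable (T : E →L[ℝ] F) {n : ℕ}

theorem ofReal_abs_det_le_detSup {x : Fin n → E} {f : Fin n → StrongDual ℝ F}
    (hx : ∀ j, ‖x j‖ ≤ 1) (hf : ∀ i, ‖f i‖ ≤ 1) :
    ENNReal.ofReal |(dualMatrix T x f).det| ≤ detSup T n :=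
  le_iSup_of_le x <| le_iSup_of_le f <| le_iSup_of_le ⟨hx, hf⟩ le_rfl

theorem detSup_ne_top (n : ℕ) : detSup T n ≠ ⊤ := by
  refine ne_top_of_le_ne_top
    (ENNReal.ofReal_ne_top (r := (Fintype.card (Fin n)).factorial • ‖T‖ ^ Fintype.card (Fin n)))
    (iSup_le fun x => iSup_le fun f => iSup_le fun h => ENNReal.ofReal_le_ofReal ?_)
  refine Matrix.det_le (abv := (AbsoluteValue.abs : AbsoluteValue ℝ ℝ)) fun i j => ?_
  calc ‖f i (T (x j))‖ ≤ ‖f i‖ * ‖T (x j)‖ := (f i).le_opNorm _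
    _ ≤ 1 * (‖T‖ * 1) := by
      gcongr
      · exact h.2 i
      · exact T.le_opNorm_of_le (h.1 j)
    _ = ‖T‖ := by ring

theorem abs_det_le_toReal_detSup {x : Fin n → E} {f : Fin n → StrongDual ℝ F}
    (hx : ∀ j, ‖x j‖ ≤ 1) (hf : ∀ i, ‖f i‖ ≤ 1) :
    |(dualMatrix T x f).det| ≤ (detSup T n).toReal :=
  (ENNReal.ofReal_le_iff_le_toReal (detSup_ne_top T n)).1 (ofReal_abs_det_le_detSup T hx hf)

theorem detSup_zero : detSup T 0 ≠ 0 := by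
  have h := ofReal_abs_det_le_detSup T (x := (Fin.elim0 : Fin 0 → E))
    (f := Fin.elim0) (fun j => j.elim0) (fun i => i.elim0)
  intro h0
  simp [h0] at h

/-- If the image of the unit ball of `span x` lies in `c U_F + L` with `dim L ≤ n`, the
determinant of order `n + 1` built from `x` is controlled by determinants of order `n`. -/
theorem abs_det_le_of_subset {x : Fin (n + 1) → E} {f : Fin (n + 1) → StrongDual ℝ F}
    (hx : ∀ j, ‖x j‖ ≤ 1) (hf : ∀ i, ‖f i‖ ≤ 1) {c : ℝ} (hc : 0 < c) {L : Submodule ℝ F}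
    (hL : Module.rank ℝ L < (n + 1 : ℕ)) (hsub : ∀ j, T (x j) ∈
      c • Metric.closedBall (0 : F) 1 + (L : Set F)) :
    |(dualMatrix T x f).det| ≤ ((n + 1 : ℕ) : ℝ) ^ 2 * c * (detSup T n).toReal := by
  have hdec : ∀ j, ∃ y : F, ‖y‖ ≤ c ∧ ∃ l : L, T (x j) = y + l := fun j => by
    obtain ⟨y, hy, l, hl, h⟩ := Set.mem_add.1 (hsub j)
    exact ⟨y, (mem_smul_unitClosedBall_iff hc).1 hy, ⟨l, hl⟩, h.symm⟩
  choose y hy l hl using hdec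
  have hdep : ¬ LinearIndependent ℝ l := fun h => by
    have := h.cardinal_lift_le_rank
    simp only [Cardinal.mk_fin, Cardinal.lift_natCast] at this
    have hL' := Cardinal.lift_lt.2 hL
    rw [Cardinal.lift_natCast] at hL'
    exact absurd (this.trans_lt hL') (lt_irrefl _)
  obtain ⟨g, hg, i₁, hi₁⟩ := Fintype.not_linearIndependent_iff.1 hdep
  obtain ⟨j₀, -, hj₀⟩ := Finset.exists_max_image Finset.univ (fun j => |g j|) ⟨i₁, Finset.mem_univ _⟩
  have hpos : 0 < |g j₀| := (abs_pos.2 hi₁).trans_le (hj₀ i₁ (Finset.mem_univ _))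
  have hTy : ∑ j, g j • T (x j) = ∑ j, g j • y j := by
    have hg' : ∑ j, g j • (l j : F) = 0 := by simpa using congrArg (Subtype.val) hg
    simp only [hl, smul_add, Finset.sum_add_distrib, hg', add_zero]
  set A := dualMatrix T x f with hA
  have hentry : ∀ i, |∑ j, g j • A i j| ≤ (n + 1 : ℕ) * (|g j₀| * c) := fun i => by
    have h1 : ∑ j, g j • A i j = f i (∑ j, g j • y j) := by
      rw [← hTy]; simp [hA, dualMatrix]
    have h2 : ‖∑ j, g j • y j‖ ≤ (n + 1 : ℕ) * (|g j₀| * c) := by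
      refine (norm_sum_le_of_le (f := fun j => g j • y j) Finset.univ
        (n := fun _ => |g j₀| * c) fun j hj => ?_).trans (by simp)
      rw [norm_smul]
      exact mul_le_mul (hj₀ j hj) (hy j) (norm_nonneg _) (abs_nonneg _)
    rw [h1]
    exact ((f i).le_of_opNorm_le (hf i) _).trans (by simpa using h2)
  have hdet := Matrix.det_updateCol_sum A j₀ g
  rw [Matrix.det_succ_column _ j₀] at hdet
  have hbound : |g j₀| * |A.det| ≤
      |g j₀| * (((n + 1 : ℕ) : ℝ) ^ 2 * c * (detSup T n).toReal) := by
    rw [← abs_mul, ← smul_eq_mul (g j₀), ← hdet]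
    refine (Finset.abs_sum_le_sum_abs _ _).trans
      ((Finset.sum_le_sum (g := fun _ => (n + 1 : ℕ) * (|g j₀| * c) * (detSup T n).toReal)
        fun i _ => ?_).trans (le_of_eq (by simp; ring)))
    rw [abs_mul, abs_mul, abs_pow, abs_neg, abs_one, one_pow, one_mul, Matrix.updateCol_self]
    refine mul_le_mul (hentry i) ?_ (abs_nonneg _) (by positivity)
    rw [Matrix.submatrix_updateCol_succAbove]
    exact abs_det_le_toReal_detSup T (x := x ∘ j₀.succAbove) (f := f ∘ i.succAbove)
      (fun _ => hx _) (fun _ => hf _)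
  exact le_of_mul_le_mul_left hbound hpos

theorem detSup_succ_le (hn : detSup T n ≠ 0) :
    detSup T (n + 1) ≤ ((n + 1 : ℕ) : ℝ≥0∞) ^ 2 * lkOp T (n + 1) * detSup T n := by
  refine iSup_le fun x => iSup_le fun f => iSup_le fun ⟨hx, hf⟩ => ?_
  set N := Submodule.span ℝ (Set.range x)
  have hle : kolDiam (T '' ((N : Set E) ∩ Metric.closedBall 0 1)) (Metric.closedBall 0 1) (n + 1) ≤
      lkOp T (n + 1) := le_iSup₂_of_le N (rank_span_range_fin_le x) le_rfl
  set K : ℝ≥0∞ := ((n + 1 : ℕ) : ℝ≥0∞) ^ 2 * detSup T n with hK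
  have hKtop : K ≠ ⊤ :=
    ENNReal.mul_ne_top (ENNReal.pow_ne_top (ENNReal.natCast_ne_top _)) (detSup_ne_top T n)
  have hK0 : K ≠ 0 := mul_ne_zero (by positivity) hn
  have hdiv : ENNReal.ofReal |(dualMatrix T x f).det| / K ≤ lkOp T (n + 1) := by
    refine le_trans (le_sInf ?_) hle
    rintro _ ⟨c, ⟨hc, L, hL, hsub⟩, rfl⟩
    refine ENNReal.div_le_of_le_mul ?_
    have h := abs_det_le_of_subset T hx hf hc hL fun j =>
      hsub ⟨x j, ⟨Submodule.subset_span ⟨j, rfl⟩, by simpa using hx j⟩, rfl⟩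
    refine (ENNReal.ofReal_le_ofReal h).trans (le_of_eq ?_)
    rw [ENNReal.ofReal_mul (by positivity), ENNReal.ofReal_mul (by positivity),
      ENNReal.ofReal_toReal (detSup_ne_top T n), ENNReal.ofReal_pow (by positivity),
      ENNReal.ofReal_natCast, hK]
    ring
  rw [mul_right_comm, ← hK, mul_comm]
  exact (ENNReal.div_le_iff hK0 hKtop).1 hdiv

theorem dkOp_mul_detSup_le (n : ℕ) : dkOp T (n + 1) * detSup T n ≤ detSup T (n + 1) := by
  simp only [detSup.eq_def T n, ENNReal.mul_iSup]
  refine iSup_le fun x => iSup_le fun f => iSup_le fun ⟨hx, hf⟩ => ?_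
  set D := (dualMatrix T x f).det with hD
  by_cases hD0 : D = 0
  · simp [hD0]
  have hDpos : 0 < |D| := abs_pos.2 hD0
  rw [← ENNReal.le_div_iff_mul_le (Or.inl (by simpa using hD0)) (Or.inl ENNReal.ofReal_ne_top)]
  refine le_of_forall_gt fun b hb => ?_
  obtain ⟨c, hc0, hc1, hc2⟩ := ENNReal.lt_iff_exists_real_btwn.1 hb
  have hcpos : 0 < c := ENNReal.ofReal_pos.1 (bot_le.trans_lt hc1)
  refine lt_of_le_of_lt (sInf_le ⟨c, ⟨hcpos, Submodule.span ℝ (Set.range (T ∘ x)), ?_, ?_⟩, rfl⟩) hc2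
  · exact (rank_span_range_fin_le _).trans_lt (by exact_mod_cast Nat.lt_succ_self n)
  rintro _ ⟨x₀, hx₀, rfl⟩
  have hΔ : (detSup T (n + 1)).toReal ≤ c * |D| := by
    rw [ENNReal.div_lt_iff (Or.inl (by simpa using hD0)) (Or.inl ENNReal.ofReal_ne_top),
      ← ENNReal.ofReal_mul hc0] at hc1
    exact ENNReal.toReal_le_of_le_ofReal (by positivity) hc1.le
  set X : Fin (n + 1) → E := Fin.cons x₀ x with hX
  have hX1 : ∀ j, ‖X j‖ ≤ 1 := Fin.cases (by simpa [hX] using hx₀) (by simpa [hX] using hx)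
  set m : Fin (n + 1) → ℝ := fun j =>
    (-1) ^ (j : ℕ) * (dualMatrix T (X ∘ j.succAbove) f).det with hm
  have hm0 : m 0 = D := by simp [hm, hD, hX, Function.comp_def]
  set v : F := ∑ j, m j • T (X j) with hv
  have hvnorm : ‖v‖ ≤ c * |D| := by
    refine norm_le_of_forall_dual_le fun f₀ hf₀ => ?_
    have h := abs_det_le_toReal_detSup T hX1 (f := Fin.cons f₀ f) (Fin.cases hf₀ hf)
    refine le_trans (le_of_eq (congrArg _ ?_)) (h.trans hΔ)
    rw [Matrix.det_succ_row_zero, hv, map_sum]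
    refine Finset.sum_congr rfl fun j _ => ?_
    rw [map_smul, smul_eq_mul, hm]
    simp only [mul_right_comm]
    rfl
  have hv' : v = D • T x₀ + ∑ j : Fin n, m j.succ • T (x j) := by
    rw [hv, Fin.sum_univ_succ, hm0]
    simp [hX]
  refine Set.mem_add.2 ⟨D⁻¹ • v, ?_, -(D⁻¹ • ∑ j : Fin n, m j.succ • T (x j)), ?_, ?_⟩
  · rw [mem_smul_unitClosedBall_iff hcpos, norm_smul, norm_inv, Real.norm_eq_abs,
      inv_mul_le_iff₀ hDpos, mul_comm]
    exact hvnorm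
  · exact Submodule.neg_mem _ (Submodule.smul_mem _ _ (Submodule.sum_mem _ fun j _ =>
      Submodule.smul_mem _ _ (Submodule.subset_span ⟨j, rfl⟩)))
  · rw [hv', smul_add, inv_smul_smul₀ hD0, add_neg_cancel_right]

theorem dkOp_eq_zero_of_detSup_eq_zero (n : ℕ) (h : detSup T n = 0) : dkOp T n = 0 := by
  induction n with
  | zero => exact absurd h (detSup_zero T)
  | succ n ih =>
    by_cases hn : detSup T n = 0
    · exact le_antisymm ((kolDiam_succ_le _ _ n).trans (ih hn).le) bot_le
    · have := dkOp_mul_detSup_le T n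
      rw [h, nonpos_iff_eq_zero, mul_eq_zero] at this
      exact this.resolve_right hn

theorem dkOp_succ_le (n : ℕ) :
    dkOp T (n + 1) ≤ ((n + 1 : ℕ) : ℝ≥0∞) ^ 2 * lkOp T (n + 1) := by
  by_cases h : detSup T n = 0
  · exact ((kolDiam_succ_le _ _ n).trans (dkOp_eq_zero_of_detSup_eq_zero T n h).le).trans bot_le
  · exact (ENNReal.mul_le_mul_iff_left h (detSup_ne_top T n)).1
      ((dkOp_mul_detSup_le T n).trans (detSup_succ_le T h))

end DetSup

theorem lk_le_dk_le_ksq_lk {E F : Type*} [SeminormedAddCommGroup E] [NormedSpace ℝ E]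
    [SeminormedAddCommGroup F] [NormedSpace ℝ F] (T : E →L[ℝ] F) :
    ∀ k : ℕ, 1 ≤ k → lkOp T k ≤ dkOp T k ∧ dkOp T k ≤ (k : ℝ≥0∞) ^ 2 * lkOp T k := by
  intro k hk
  obtain ⟨n, rfl⟩ := Nat.exists_eq_add_of_le' hk
  exact ⟨lkOp_le_dkOp T _, dkOp_succ_le T n⟩
end

section
/- Let A and B be symmetric convex subsets of a real vector space E, and assume B is absorbing. For a subset S of E let S^▷ := {φ ∈ E* : |φ(x)| ≤ 1 for all x ∈ S} denote its polar in the algebraic dual E* of E. Then for every integer k ≥ 1, d_k(B^▷, A^▷) ≤ k · d_k(A,B). -/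
open scoped Pointwise ENNReal

/-- The polar of a set `S ⊆ E` in the algebraic dual `E* = Module.Dual ℝ E`. -/
def algPolar {E : Type*} [AddCommGroup E] [Module ℝ E] (S : Set E) : Set (Module.Dual ℝ E) :=
  {φ : Module.Dual ℝ E | ∀ x ∈ S, |φ x| ≤ 1}

open Module in
/-- A compact spanning set in a finite-dimensional real vector space contains an Auerbach system:
finitely many of its points such that each of its points is a combination of these with
coefficients in `[-1, 1]`. -/
theorem IsCompact.exists_auerbach_of_span_eq_top {V : Type*} [NormedAddCommGroup V]
    [NormedSpace ℝ V] [FiniteDimensional ℝ V] {K : Set V} (hK : IsCompact K)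
    (hspan : Submodule.span ℝ K = ⊤) :
    ∃ f : Fin (finrank ℝ V) → V, (∀ i, f i ∈ K) ∧
      ∀ v ∈ K, ∃ a : Fin (finrank ℝ V) → ℝ, (∀ i, |a i| ≤ 1) ∧ v = ∑ i, a i • f i := by
  obtain ⟨b, hbK⟩ : ∃ b : Basis (Fin (finrank ℝ V)) ℝ V, ∀ i, b i ∈ K := by
    have h := Submodule.exists_fun_fin_finrank_span_eq ℝ K
    rw [hspan, finrank_top] at h
    obtain ⟨g, hgK, hgspan, hg⟩ := h
    exact ⟨Basis.mk hg hgspan.ge, fun i => by simpa using hgK i⟩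
  have hcont : Continuous fun v : Fin (finrank ℝ V) → V => |b.det v| := by
    simp only [Basis.det_apply]
    refine (Continuous.matrix_det (continuous_matrix fun i j => ?_)).abs
    exact (b.coord i).continuous_of_finiteDimensional.comp (continuous_apply j)
  obtain ⟨f, hfK, hf⟩ := (isCompact_univ_pi fun _ => hK).exists_isMaxOn
    ⟨b, fun i _ => hbK i⟩ hcont.continuousOn
  have hpos : 0 < |b.det f| := by
    have h1 : |b.det b| ≤ |b.det f| := hf (a := b) fun i _ => hbK i
    rw [b.det_self, abs_one] at h1
    linarith
  obtain ⟨hli, hsp⟩ := b.is_basis_iff_det.2 (isUnit_iff_ne_zero.2 (abs_pos.1 hpos))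
  refine ⟨f, fun i => hfK i trivial, fun v hv =>
    ⟨fun i => (Basis.mk hli hsp.ge).repr v i, fun i => ?_, ?_⟩⟩
  · have hdet := LinearMap.congr_fun (b.det_smul_mk_coord_eq_det_update hli hsp.ge i) v
    have hle : |b.det (Function.update f i v)| ≤ |b.det f| := by
      refine hf (a := Function.update f i v) fun j _ => ?_
      rcases eq_or_ne j i with rfl | hji
      · simpa using hv
      · simpa [hji] using hfK j trivial
    have heq : b.det f * (Basis.mk hli hsp.ge).repr v i = b.det (Function.update f i v) := hdet
    rw [← heq, abs_mul] at hle
    exact le_of_mul_le_mul_left (by simpa using hle) hpos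
  · simpa using ((Basis.mk hli hsp.ge).sum_repr v).symm

open Module in
theorem IsCompact.exists_auerbach {V : Type*} [NormedAddCommGroup V]
    [NormedSpace ℝ V] [FiniteDimensional ℝ V] {K : Set V} (hK : IsCompact K) :
    ∃ n ≤ finrank ℝ V, ∃ f : Fin n → V, (∀ i, f i ∈ K) ∧
      ∀ v ∈ K, ∃ a : Fin n → ℝ, (∀ i, |a i| ≤ 1) ∧ v = ∑ i, a i • f i := by
  let W := Submodule.span ℝ K
  have hK' : IsCompact ((↑) ⁻¹' K : Set W) :=
    W.closed_of_finiteDimensional.isClosedEmbedding_subtypeVal.isCompact_preimage hK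
  obtain ⟨f, hfK, hf⟩ := hK'.exists_auerbach_of_span_eq_top Submodule.span_span_coe_preimage
  refine ⟨finrank ℝ W, W.finrank_le, fun i => f i, hfK, fun v hv => ?_⟩
  obtain ⟨a, ha, hva⟩ := hf ⟨v, Submodule.subset_span hv⟩ hv
  exact ⟨a, ha, by simpa using congrArg (W.subtype) hva⟩

/-- The polar of an absorbing set is compact for pointwise convergence. -/
theorem isCompact_coe_image_algPolar {E : Type*} [AddCommGroup E] [Module ℝ E] {B : Set E}
    (hB : ∀ x : E, ∃ t : ℝ, 0 < t ∧ x ∈ t • B) :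
    IsCompact ((fun φ : Module.Dual ℝ E => (φ : E → ℝ)) '' algPolar B) := by
  choose t ht hxt using hB
  have hclosed : IsClosed ((fun φ : Module.Dual ℝ E => (φ : E → ℝ)) '' algPolar B) := by
    have heq : (fun φ : Module.Dual ℝ E => (φ : E → ℝ)) '' algPolar B =
        Set.range ((↑) : (E →ₗ[ℝ] ℝ) → E → ℝ) ∩ ⋂ x ∈ B, {g : E → ℝ | |g x| ≤ 1} := by
      ext g
      simp only [Set.mem_image, Set.mem_inter_iff, Set.mem_range, Set.mem_iInter]
      constructor
      · rintro ⟨φ, hφ, rfl⟩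
        exact ⟨⟨φ, rfl⟩, hφ⟩
      · rintro ⟨⟨φ, rfl⟩, hφ⟩
        exact ⟨φ, hφ, rfl⟩
    rw [heq]
    exact (LinearMap.isClosed_range_coe E ℝ (RingHom.id ℝ)).inter
      (isClosed_biInter fun x _ => isClosed_le (continuous_apply x).abs continuous_const)
  refine (isCompact_univ_pi fun x => isCompact_Icc (a := -t x) (b := t x)).of_isClosed_subset
    hclosed ?_
  rintro _ ⟨φ, hφ, rfl⟩ x -
  obtain ⟨y, hy, hyx⟩ := hxt x
  refine abs_le.1 (?_ : |φ x| ≤ t x)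
  calc |φ x| = t x * |φ y| := by
        rw [← abs_of_pos (ht x), ← abs_mul, ← smul_eq_mul, ← map_smul]
        exact congrArg (fun z => |φ z|) (by simpa [abs_of_pos (ht x)] using hyx.symm)
    _ ≤ t x := mul_le_of_le_one_right (ht x).le (hφ y hy)

open Module in
/-- On a finite-dimensional subspace `L`, the polar of an absorbing set is controlled by at most
`dim L` of its elements. -/
theorem exists_auerbach_algPolar {E : Type*} [AddCommGroup E] [Module ℝ E] {B : Set E}
    (hB : ∀ x : E, ∃ t : ℝ, 0 < t ∧ x ∈ t • B) (L : Submodule ℝ E) [FiniteDimensional ℝ L] :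
    ∃ n ≤ finrank ℝ L, ∃ f : Fin n → Dual ℝ E, (∀ i, f i ∈ algPolar B) ∧
      ∀ φ ∈ algPolar B, ∃ a : Fin n → ℝ, (∀ i, |a i| ≤ 1) ∧
        ∀ y ∈ L, φ y = (∑ i, a i • f i) y := by
  let e := finBasis ℝ L
  have hK := (isCompact_coe_image_algPolar hB).image
    (f := fun (g : E → ℝ) (j : Fin (finrank ℝ L)) => g (e j)) (by fun_prop)
  rw [Set.image_image] at hK
  obtain ⟨n, hn, v, hv, hspan⟩ := hK.exists_auerbach
  choose f hf hfv using hv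
  refine ⟨n, by simpa using hn, f, hf, fun φ hφ => ?_⟩
  obtain ⟨a, ha, hφa⟩ := hspan _ ⟨φ, hφ, rfl⟩
  refine ⟨a, ha, fun y hy => ?_⟩
  have hres : φ ∘ₗ L.subtype = (∑ i, a i • f i) ∘ₗ L.subtype := by
    refine e.ext fun j => ?_
    simpa [← hfv] using congrFun hφa j
  exact LinearMap.congr_fun hres ⟨y, hy⟩

theorem algPolar_subset_smul_algPolar_add {E : Type*} [AddCommGroup E] [Module ℝ E] {A B : Set E}
    (hB : ∀ x : E, ∃ t : ℝ, 0 < t ∧ x ∈ t • B) {k : ℕ} {c : ℝ} (hc : 0 < c)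
    {L : Submodule ℝ E} (hL : Module.rank ℝ L < k) (hA : A ⊆ c • B + (L : Set E)) :
    ∃ M : Submodule ℝ (Module.Dual ℝ E), Module.rank ℝ M < k ∧
      algPolar B ⊆ ((k : ℝ) * c) • algPolar A + (M : Set (Module.Dual ℝ E)) := by
  have : FiniteDimensional ℝ L :=
    Module.rank_lt_aleph0_iff.1 (hL.trans (Cardinal.natCast_lt_aleph0))
  rw [← Module.finrank_eq_rank, Nat.cast_lt] at hL
  obtain ⟨n, hn, f, hf, hspan⟩ := exists_auerbach_algPolar hB L
  have hnk : n < k := hn.trans_lt hL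
  have hkc : 0 < (k : ℝ) * c := mul_pos (by exact_mod_cast (Nat.zero_le n).trans_lt hnk) hc
  refine ⟨Submodule.span ℝ (Set.range f), ?_, fun φ hφ => ?_⟩
  · have := FiniteDimensional.span_of_finite ℝ (Set.finite_range f)
    rw [← Module.finrank_eq_rank, Nat.cast_lt]
    exact (finrank_range_le_card f).trans_lt (by simpa using hnk)
  obtain ⟨a, ha, hφa⟩ := hspan φ hφ
  refine Set.mem_add.2 ⟨φ - ∑ i, a i • f i, ?_, ∑ i, a i • f i,
    Submodule.sum_mem _ fun i _ => Submodule.smul_mem _ _ (Submodule.subset_span ⟨i, rfl⟩),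
    sub_add_cancel _ _⟩
  rw [Set.mem_smul_set_iff_inv_smul_mem₀ hkc.ne']
  intro x hx
  obtain ⟨_, ⟨b, hb, rfl⟩, y, hy, rfl⟩ := Set.mem_add.1 (hA hx)
  have hsum : |(∑ i, a i • f i) b| ≤ n := by
    simp only [LinearMap.sum_apply, LinearMap.smul_apply, smul_eq_mul]
    calc |∑ i, a i * f i b| ≤ ∑ i, |a i * f i b| := Finset.abs_sum_le_sum_abs _ _
      _ ≤ ∑ _i : Fin n, (1 : ℝ) := Finset.sum_le_sum fun i _ => by
          rw [abs_mul]
          exact mul_le_one₀ (ha i) (abs_nonneg _) (hf i b hb)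
      _ = n := by simp
  have hval : (φ - ∑ i, a i • f i) (c • b + y) = c * (φ b - (∑ i, a i • f i) b) := by
    rw [map_add, map_smul, LinearMap.sub_apply, LinearMap.sub_apply, hφa y hy, sub_self,
      add_zero, smul_eq_mul]
  have hnk' : (n : ℝ) + 1 ≤ k := by exact_mod_cast hnk
  have hdiff : |φ b - (∑ i, a i • f i) b| ≤ k :=
    (abs_sub _ _).trans (by linarith [hφ b hb])
  change |((k : ℝ) * c)⁻¹ * (φ - ∑ i, a i • f i) (c • b + y)| ≤ 1
  rw [hval, abs_mul, abs_mul, abs_inv, abs_of_pos hkc, abs_of_pos hc, inv_mul_le_one₀ hkc,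
    mul_comm (k : ℝ)]
  exact mul_le_mul_of_nonneg_left hdiff hc.le

theorem kolDiam_polar_le {E : Type*} [AddCommGroup E] [Module ℝ E] (A B : Set E)
    (hAs : -A = A) (hAc : Convex ℝ A) (hBs : -B = B) (hBc : Convex ℝ B)
    (hBabs : ∀ x : E, ∃ t : ℝ, 0 < t ∧ x ∈ t • B) :
    ∀ k : ℕ, 1 ≤ k →
      kolDiam (algPolar B) (algPolar A) k ≤ (k : ℝ≥0∞) * kolDiam A B k := by
  intro k hk
  rw [kolDiam, kolDiam, sInf_eq_iInf' (ENNReal.ofReal '' {c : ℝ | 0 < c ∧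
    ∃ L : Submodule ℝ E, Module.rank ℝ L < k ∧ A ⊆ c • B + (L : Set E)}),
    ENNReal.mul_iInf_of_ne (by simpa using Nat.one_le_iff_ne_zero.1 hk) (by simp)]
  refine le_iInf ?_
  rintro ⟨_, c, ⟨hc, L, hL, hA⟩, rfl⟩
  obtain ⟨M, hM, hsub⟩ := algPolar_subset_smul_algPolar_add hBabs hc hL hA
  refine sInf_le ⟨k * c, ⟨mul_pos (by exact_mod_cast hk) hc, M, hM, hsub⟩, ?_⟩
  rw [ENNReal.ofReal_mul (by positivity), ENNReal.ofReal_natCast]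
end
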